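/- arXiv:2405.19361 — 2 statements merged into one kernel-verified Lean document; each statement's English description precedes it below -/
import Mathlib

section
/- For any fixed s ∈ (0,1), the function t ↦ h(st)/h(t)^s tends to 1/2^{1−s} as t → 0⁺ and tends to 1 as t → ∞; consequently (together with its increasing monotonicity) it maps (0,∞) onto the interval (1/2^{1−s}, 1). -/
open Filter Set

noncomputable def h (t : ℝ) : ℝ :=
  if t = 0 then 1 / 2 else Real.exp t * (Real.exp t - 1 - t) / (Real.exp t - 1) ^ 2

lemma three_mul_exp_sq_sub_one_le {t : ℝ} (ht : 0 ≤ t) :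
    3 * (Real.exp t ^ 2 - 1) ≤ t * (Real.exp t ^ 2 + 4 * Real.exp t + 1) := by
  have hD : ∀ x : ℝ, 0 < Real.exp x ^ 2 + 4 * Real.exp x + 1 := fun x => by positivity
  have hd : ∀ x : ℝ, HasDerivAt
      (fun x => x - 3 * (Real.exp x ^ 2 - 1) / (Real.exp x ^ 2 + 4 * Real.exp x + 1))
      ((Real.exp x - 1) ^ 4 / (Real.exp x ^ 2 + 4 * Real.exp x + 1) ^ 2) x := by
    intro x
    have hx := Real.hasDerivAt_exp x
    have hnum := ((hx.pow 2).sub_const 1).const_mul 3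
    have hden := ((hx.pow 2).add (hx.const_mul 4)).add_const 1
    have hne := (hD x).ne'
    refine ((hasDerivAt_id x).sub (hnum.div hden hne)).congr_deriv ?_
    simp only [Pi.add_apply, Pi.pow_apply]
    field_simp
    ring
  have hmono : Monotone
      (fun x => x - 3 * (Real.exp x ^ 2 - 1) / (Real.exp x ^ 2 + 4 * Real.exp x + 1)) :=
    monotone_of_deriv_nonneg (fun x => (hd x).differentiableAt)
      (fun x => by rw [(hd x).deriv]; have := hD x; positivity)
  have key := hmono ht
  simp only [Real.exp_zero] at key
  norm_num at key
  rwa [div_le_iff₀ (hD t)] at key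

lemma h_of_pos {t : ℝ} (ht : 0 < t) :
    h t = Real.exp t * (Real.exp t - 1 - t) / (Real.exp t - 1) ^ 2 := if_neg ht.ne'

lemma h_zero : h 0 = 1 / 2 := if_pos rfl

lemma exp_sub_one_pos {t : ℝ} (ht : 0 < t) : 0 < Real.exp t - 1 := by
  linarith [Real.add_one_lt_exp ht.ne']

lemma half_le_h {t : ℝ} (ht : 0 ≤ t) : 1 / 2 ≤ h t := by
  rcases ht.eq_or_lt with rfl | ht
  · exact h_zero.ge
  have hE := exp_sub_one_pos ht
  rw [h_of_pos ht, div_le_div_iff₀ two_pos (by positivity)]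
  have hs := Real.self_le_sinh_iff.2 ht.le
  rw [Real.sinh_eq] at hs
  have hx := Real.exp_pos t
  have hinv : Real.exp t * Real.exp (-t) = 1 := by rw [← Real.exp_add]; simp
  nlinarith [mul_le_mul_of_nonneg_left hs hx.le]

lemma h_le {t : ℝ} (ht : 0 ≤ t) :
    h t ≤ Real.exp t * (Real.exp t + 2) / (Real.exp t ^ 2 + 4 * Real.exp t + 1) := by
  rcases ht.eq_or_lt with rfl | ht
  · norm_num [h_zero]
  have hE := exp_sub_one_pos ht
  have hx := Real.exp_pos t
  rw [h_of_pos ht, div_le_div_iff₀ (by positivity) (by positivity), mul_assoc, mul_assoc]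
  refine mul_le_mul_of_nonneg_left ?_ hx.le
  nlinarith [three_mul_exp_sq_sub_one_le ht.le]

lemma h_pos {t : ℝ} (ht : 0 ≤ t) : 0 < h t := by linarith [half_le_h ht]

lemma h_lt_one {t : ℝ} (ht : 0 ≤ t) : h t < 1 := by
  refine (h_le ht).trans_lt ?_
  have hx := Real.exp_pos t
  rw [div_lt_one (by positivity)]
  nlinarith

lemma continuousOn_h : ContinuousOn h (Ici 0) := by
  intro t ht
  rcases (mem_Ici.1 ht).eq_or_lt with rfl | ht
  · have hup : Tendsto
        (fun t : ℝ => Real.exp t * (Real.exp t + 2) / (Real.exp t ^ 2 + 4 * Real.exp t + 1))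
        (nhdsWithin 0 (Ici 0)) (nhds (1 / 2)) := by
      have hc : Continuous
          (fun t : ℝ => Real.exp t * (Real.exp t + 2) /
            (Real.exp t ^ 2 + 4 * Real.exp t + 1)) :=
        Continuous.div (by fun_prop) (by fun_prop) (fun x => by positivity)
      have h0 := hc.tendsto 0
      norm_num at h0
      norm_num
      exact h0.mono_left nhdsWithin_le_nhds
    rw [ContinuousWithinAt, h_zero]
    exact tendsto_of_tendsto_of_tendsto_of_le_of_le' tendsto_const_nhds hup
      (eventually_mem_nhdsWithin.mono fun _ hx => half_le_h hx)
      (eventually_mem_nhdsWithin.mono fun _ hx => h_le hx)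
  · have hE := exp_sub_one_pos ht
    have hc : ContinuousAt
        (fun t => Real.exp t * (Real.exp t - 1 - t) / (Real.exp t - 1) ^ 2) t :=
      ContinuousAt.div (by fun_prop) (by fun_prop) (by positivity)
    refine (hc.congr ?_).continuousWithinAt
    filter_upwards [Ioi_mem_nhds ht] with x hx using (h_of_pos hx).symm

lemma hasDerivAt_log_h {t : ℝ} (ht : 0 < t) :
    HasDerivAt (fun x => Real.log (h x))
      (t / (Real.exp t - 1 - t) - 2 / (Real.exp t - 1)) t := by
  have hE := exp_sub_one_pos ht
  have hEt : 0 < Real.exp t - 1 - t := by linarith [Real.add_one_lt_exp ht.ne']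
  have hx := Real.hasDerivAt_exp t
  have hN := ((hx.sub_const 1).sub (hasDerivAt_id t)).log hEt.ne'
  have hM := ((hx.sub_const 1).log hE.ne').const_mul 2
  have hsum := ((hasDerivAt_id t).add hN).sub hM
  refine (hsum.congr_of_eventuallyEq ?_).congr_deriv ?_
  · filter_upwards [Ioi_mem_nhds ht] with x hx
    have hE' := exp_sub_one_pos hx
    have hEt' : 0 < Real.exp x - 1 - x := by
      linarith [Real.add_one_lt_exp (ne_of_gt (mem_Ioi.1 hx))]
    rw [h_of_pos hx, Real.log_div (by positivity) (by positivity),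
      Real.log_mul (by positivity) hEt'.ne', Real.log_exp, Real.log_pow]
    simp
  · have h1 := hE.ne'
    have h2 := hEt.ne'
    simp only [Pi.sub_apply, id]
    field_simp
    ring

lemma strictAntiOn_logDeriv_h :
    StrictAntiOn (fun t => t / (Real.exp t - 1 - t) - 2 / (Real.exp t - 1)) (Ioi 0) := by
  have hd : ∀ t ∈ Ioi (0 : ℝ), HasDerivAt
      (fun t => t / (Real.exp t - 1 - t) - 2 / (Real.exp t - 1))
      (((Real.exp t - 1 - t) - t * (Real.exp t - 1)) / (Real.exp t - 1 - t) ^ 2 +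
        2 * Real.exp t / (Real.exp t - 1) ^ 2) t := by
    intro t ht
    have hE := exp_sub_one_pos ht
    have hEt : 0 < Real.exp t - 1 - t := by
      linarith [Real.add_one_lt_exp (ne_of_gt (mem_Ioi.1 ht))]
    have hx := Real.hasDerivAt_exp t
    refine (((hasDerivAt_id t).div ((hx.sub_const 1).sub (hasDerivAt_id t)) hEt.ne').sub
      ((hasDerivAt_const t 2).div (hx.sub_const 1) hE.ne')).congr_deriv ?_
    have h1 := hE.ne'
    have h2 := hEt.ne'
    simp only [Pi.sub_apply, id]
    field_simp
    ring
  refine strictAntiOn_of_deriv_neg (convex_Ioi 0)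
    (fun t ht => (hd t ht).continuousAt.continuousWithinAt) (fun t ht => ?_)
  rw [interior_Ioi] at ht
  rw [(hd t ht).deriv]
  have hE := exp_sub_one_pos ht
  have hEt : 0 < Real.exp t - 1 - t := by
    linarith [Real.add_one_lt_exp (ne_of_gt (mem_Ioi.1 ht))]
  have hl := three_mul_exp_sq_sub_one_le (le_of_lt (mem_Ioi.1 ht))
  rw [div_add_div _ _ (by positivity) (by positivity)]
  refine div_neg_of_neg_of_pos ?_ (by positivity)
  obtain ⟨E, hEdef⟩ : ∃ E, E = Real.exp t - 1 := ⟨_, rfl⟩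
  have hexp : Real.exp t = E + 1 := by linarith
  rw [hexp] at hl hE hEt ⊢
  simp only [add_sub_cancel_right] at hE hEt ⊢
  obtain ⟨D, hD⟩ : ∃ D, D = E ^ 2 + 6 * E + 6 := ⟨_, rfl⟩
  have hDpos : 0 < D := by rw [hD]; positivity
  -- The negated numerator is concave in `t`; it is positive at both ends of
  -- the interval `[3 * E * (E + 2) / D, E]`, which contains `t`.
  obtain ⟨a, ha⟩ : ∃ a, a = t * D - 3 * E * (E + 2) := ⟨_, rfl⟩
  have ha0 : 0 ≤ a := by rw [ha, hD]; nlinarith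
  have hid : (E + 3) * D * -((E - t - t * E) * E ^ 2 + (E - t) ^ 2 * (2 * (E + 1))) =
      2 * (E + 1) * (E + 3) * a * (E - t) + (E - t) * E ^ 4 + a * D * E ^ 2 := by
    rw [ha, hD]; ring
  refine neg_pos.1 (pos_of_mul_pos_right (a := (E + 3) * D) ?_ (by positivity))
  rw [hid]
  positivity

lemma strictConcaveOn_log_h : StrictConcaveOn ℝ (Ici 0) (fun t => Real.log (h t)) := by
  refine StrictAntiOn.strictConcaveOn_of_deriv (convex_Ici 0)
    (continuousOn_h.log fun t ht => (h_pos ht).ne') ?_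
  rw [interior_Ici]
  exact strictAntiOn_logDeriv_h.congr fun t ht => (hasDerivAt_log_h ht).deriv.symm

lemma monotoneOn_log_h : MonotoneOn (fun t => Real.log (h t)) (Ici 0) := by
  refine monotoneOn_of_deriv_nonneg (convex_Ici 0)
    (continuousOn_h.log fun t ht => (h_pos ht).ne') ?_ ?_ <;> rw [interior_Ici]
  · exact fun t ht => (hasDerivAt_log_h ht).differentiableAt.differentiableWithinAt
  intro t ht
  rw [(hasDerivAt_log_h ht).deriv, sub_nonneg]
  have hE := exp_sub_one_pos ht
  have hEt : 0 < Real.exp t - 1 - t := by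
    linarith [Real.add_one_lt_exp (ne_of_gt (mem_Ioi.1 ht))]
  have hl := three_mul_exp_sq_sub_one_le (le_of_lt (mem_Ioi.1 ht))
  rw [div_le_div_iff₀ hE hEt]
  have : 0 ≤ (Real.exp t ^ 2 + 4 * Real.exp t + 1) *
      (t * (Real.exp t - 1) - 2 * (Real.exp t - 1 - t)) := by
    nlinarith [mul_le_mul_of_nonneg_right hl (by positivity : 0 ≤ Real.exp t + 1),
      pow_pos hE 3]
  nlinarith [nonneg_of_mul_nonneg_right this (by positivity)]

lemma tendsto_h_atTop : Tendsto h atTop (nhds 1) := by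
  have hu : Tendsto (fun t : ℝ => Real.exp (-t)) atTop (nhds 0) :=
    Real.tendsto_exp_neg_atTop_nhds_zero
  have htu : Tendsto (fun t : ℝ => t * Real.exp (-t)) atTop (nhds 0) := by
    simpa using Real.tendsto_pow_mul_exp_neg_atTop_nhds_zero 1
  have hlim : Tendsto
      (fun t : ℝ => (1 - Real.exp (-t) - t * Real.exp (-t)) / (1 - Real.exp (-t)) ^ 2)
      atTop (nhds 1) := by
    have := (((tendsto_const_nhds (x := (1 : ℝ))).sub hu).sub htu).div
      (((tendsto_const_nhds (x := (1 : ℝ))).sub hu).pow 2) (by norm_num)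
    norm_num at this
    exact this
  refine hlim.congr' ?_
  filter_upwards [eventually_gt_atTop 0] with t ht
  have hE := (exp_sub_one_pos ht).ne'
  rw [h_of_pos ht, Real.exp_neg]
  have : 1 - (Real.exp t)⁻¹ ≠ 0 := by
    have : 1 - (Real.exp t)⁻¹ = (Real.exp t - 1) / Real.exp t := by field_simp
    rw [this]; positivity
  field_simp

lemma continuousOn_h_ratio {s : ℝ} (hs : 0 < s) :
    ContinuousOn (fun t : ℝ => h (s * t) / (h t) ^ s) (Ici 0) := by
  refine ContinuousOn.div ?_ (continuousOn_h.rpow_const fun t ht => Or.inl (h_pos ht).ne')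
    fun t ht => (Real.rpow_pos_of_pos (h_pos ht) s).ne'
  exact continuousOn_h.comp (by fun_prop) fun t ht => mul_nonneg hs.le ht

lemma h_ratio_zero (s : ℝ) : h (s * 0) / (h 0) ^ s = 1 / (2 : ℝ) ^ (1 - s) := by
  rw [mul_zero, h_zero, Real.rpow_sub two_pos, Real.rpow_one,
    Real.div_rpow one_pos.le two_pos.le, Real.one_rpow]
  field_simp

lemma h_ratio_lt_one {s t : ℝ} (hs : s ∈ Ioo (0 : ℝ) 1) (ht : 0 < t) :
    h (s * t) / (h t) ^ s < 1 := by
  have hst : 0 ≤ s * t := mul_nonneg hs.1.le ht.le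
  rw [div_lt_one (Real.rpow_pos_of_pos (h_pos ht.le) s)]
  calc h (s * t) ≤ h t := (Real.log_le_log_iff (h_pos hst) (h_pos ht.le)).1
        (monotoneOn_log_h hst ht.le (mul_le_of_le_one_left ht.le hs.2.le))
    _ = h t ^ (1 : ℝ) := (Real.rpow_one _).symm
    _ < h t ^ s := Real.rpow_lt_rpow_of_exponent_gt (h_pos ht.le) (h_lt_one ht.le) hs.2

lemma lt_h_ratio {s t : ℝ} (hs : s ∈ Ioo (0 : ℝ) 1) (ht : 0 < t) :
    1 / (2 : ℝ) ^ (1 - s) < h (s * t) / (h t) ^ s := by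
  have hst : 0 ≤ s * t := mul_nonneg hs.1.le ht.le
  have hc := strictConcaveOn_log_h.2 (mem_Ici.2 ht.le) self_mem_Ici ht.ne' hs.1
    (sub_pos.2 hs.2) (add_sub_cancel s 1)
  simp only [smul_eq_mul, mul_zero, add_zero, h_zero] at hc
  have hp := Real.rpow_pos_of_pos (h_pos ht.le) s
  rw [← Real.log_lt_log_iff (by positivity) (div_pos (h_pos hst) hp),
    Real.log_div (h_pos hst).ne' hp.ne', Real.log_rpow (h_pos ht.le), one_div, Real.log_inv,
    Real.log_rpow two_pos]
  rw [one_div, Real.log_inv] at hc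
  linarith

theorem h_ratio_limits (s : ℝ) (hs : s ∈ Set.Ioo (0:ℝ) 1) :
    Tendsto (fun t : ℝ => h (s * t) / (h t) ^ s) (nhdsWithin 0 (Set.Ioi 0))
      (nhds (1 / (2:ℝ) ^ (1 - s))) ∧
    Tendsto (fun t : ℝ => h (s * t) / (h t) ^ s) atTop (nhds 1) ∧
    (fun t : ℝ => h (s * t) / (h t) ^ s) '' (Set.Ioi 0) =
      Set.Ioo (1 / (2:ℝ) ^ (1 - s)) 1 := by
  have hzero : Tendsto (fun t : ℝ => h (s * t) / (h t) ^ s) (nhdsWithin 0 (Set.Ioi 0))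
      (nhds (1 / (2:ℝ) ^ (1 - s))) := by
    rw [← h_ratio_zero s]
    exact (continuousOn_h_ratio hs.1 0 self_mem_Ici).tendsto.mono_left
      (nhdsWithin_mono 0 Ioi_subset_Ici_self)
  have htop : Tendsto (fun t : ℝ => h (s * t) / (h t) ^ s) atTop (nhds 1) := by
    have := (tendsto_h_atTop.comp (tendsto_id.const_mul_atTop hs.1)).div
      (tendsto_h_atTop.rpow_const (p := s) (Or.inl one_ne_zero)) (by simp)
    rwa [Real.one_rpow, div_one] at this
  refine ⟨hzero, htop, Subset.antisymm ?_ ?_⟩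
  · rintro _ ⟨t, ht, rfl⟩
    exact ⟨lt_h_ratio hs ht, h_ratio_lt_one hs ht⟩
  · exact isPreconnected_Ioi.intermediate_value_Ioo (le_principal_iff.2 self_mem_nhdsWithin)
      (le_principal_iff.2 (Ioi_mem_atTop 0))
      ((continuousOn_h_ratio hs.1).mono Ioi_subset_Ici_self) hzero htop
end

section
/- For all nonnegative integers m and n, the function Y_{m,n}(x) = Φ^{(m+n+1)}(x) / (Φ^{(m)}(x) Φ^{(n)}(x)) is strictly decreasing in x on (0,∞). -/
/-- `Φ x = x * ψ'(x) - 1`, where `ψ'` is the trigamma function, i.e. the second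
derivative of the logarithm of the gamma function. -/
noncomputable def Phi (x : ℝ) : ℝ :=
  x * iteratedDeriv 2 (fun y => Real.log (Real.Gamma y)) x - 1

noncomputable def Y (m n : ℕ) (x : ℝ) : ℝ :=
  iteratedDeriv (m + n + 1) Phi x / (iteratedDeriv m Phi x * iteratedDeriv n Phi x)

open Real Set Filter Topology MeasureTheory

lemma pos_of_hasDerivAt_pos {f f' : ℝ → ℝ} (hf : ∀ t, HasDerivAt f (f' t) t) (h0 : 0 ≤ f 0)
    (hpos : ∀ t, 0 < t → 0 < f' t) {t : ℝ} (ht : 0 < t) : 0 < f t := by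
  have hmono : StrictMonoOn f (Ici 0) := by
    refine strictMonoOn_of_deriv_pos (convex_Ici 0)
      (fun s _ => (hf s).continuousAt.continuousWithinAt) fun s hs => ?_
    rw [interior_Ici] at hs
    rw [(hf s).deriv]
    exact hpos s hs
  exact h0.trans_lt (hmono self_mem_Ici (mem_Ici.2 ht.le) ht)

/-- A combination of `1, exp t, exp (2t), exp (3t)` with polynomial coefficients. -/
noncomputable def expPoly (a₁ a₀ b₁ b₀ c₂ c₁ c₀ d t : ℝ) : ℝ :=
  (a₁ * t + a₀) * exp t ^ 3 + (b₁ * t + b₀) * exp t ^ 2 + (c₂ * t ^ 2 + c₁ * t + c₀) * exp t + d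

lemma hasDerivAt_expPoly (a₁ a₀ b₁ b₀ c₂ c₁ c₀ d t : ℝ) :
    HasDerivAt (expPoly a₁ a₀ b₁ b₀ c₂ c₁ c₀ d)
      (expPoly (3 * a₁) (3 * a₀ + a₁) (2 * b₁) (2 * b₀ + b₁) c₂ (c₁ + 2 * c₂) (c₀ + c₁) 0 t) t := by
  have hlin (a b : ℝ) : HasDerivAt (fun s : ℝ => a * s + b) a t := by
    simpa using ((hasDerivAt_id t).const_mul a).add_const b
  have hquad : HasDerivAt (fun s : ℝ => c₂ * s ^ 2 + c₁ * s + c₀) (c₂ * (2 * t) + c₁) t := by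
    simpa using ((((hasDerivAt_id t).pow 2).const_mul c₂).add
      ((hasDerivAt_id t).const_mul c₁)).add_const c₀
  have h := ((((hlin a₁ a₀).mul ((hasDerivAt_exp t).pow 3)).add
    ((hlin b₁ b₀).mul ((hasDerivAt_exp t).pow 2))).add
    (hquad.mul (hasDerivAt_exp t))).add_const d
  refine h.congr_deriv ?_
  simp only [expPoly, Pi.pow_apply]
  push_cast
  ring

lemma expPoly_pos_of_deriv {a₁ a₀ b₁ b₀ c₂ c₁ c₀ d : ℝ} (h0 : 0 ≤ a₀ + b₀ + c₀ + d)
    (h : ∀ t, 0 < t → 0 <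
      expPoly (3 * a₁) (3 * a₀ + a₁) (2 * b₁) (2 * b₀ + b₁) c₂ (c₁ + 2 * c₂) (c₀ + c₁) 0 t)
    (t : ℝ) (ht : 0 < t) : 0 < expPoly a₁ a₀ b₁ b₀ c₂ c₁ c₀ d t :=
  pos_of_hasDerivAt_pos (hasDerivAt_expPoly a₁ a₀ b₁ b₀ c₂ c₁ c₀ d)
    (by simpa [expPoly] using h0) h ht

lemma expPoly_eq_exp_mul (a₁ a₀ b₁ b₀ c₂ c₁ c₀ t : ℝ) :
    expPoly a₁ a₀ b₁ b₀ c₂ c₁ c₀ 0 t =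
      exp t * ((a₁ * t + a₀) * exp t ^ 2 + (b₁ * t + b₀) * exp t + (c₂ * t ^ 2 + c₁ * t + c₀)) := by
  simp only [expPoly]; ring

lemma exp_quadratic_pos (t : ℝ) (ht : 0 < t) :
    0 < (729 * t - 729) * exp t ^ 2 + (128 * t + 832) * exp t - (2 * t ^ 2 + 27 * t + 83) := by
  have hE := hasDerivAt_exp
  have hlin (a b s : ℝ) : HasDerivAt (fun s : ℝ => a * s + b) a s := by
    simpa using ((hasDerivAt_id s).const_mul a).add_const b
  have h1 : ∀ t, 0 < t →
      0 < (1458 * t + (-729)) * exp t ^ 2 + (128 * t + 960) * exp t + ((-4) * t + (-27)) := by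
    intro t ht
    refine pos_of_hasDerivAt_pos
      (f' := fun t => 2916 * t * exp t ^ 2 + (128 * t + 1088) * exp t - 4)
      (fun s => ((((hlin 1458 (-729) s).mul ((hE s).pow 2)).add
        ((hlin 128 960 s).mul (hE s))).add (hlin (-4) (-27) s)).congr_deriv ?_)
      (by norm_num) (fun s hs => ?_) ht
    · simp only [Pi.pow_apply]; push_cast; ring
    · have : 1 < exp s := one_lt_exp_iff.2 hs
      have h2 : 0 < 2916 * s * exp s ^ 2 := by positivity
      have h3 : 0 < 128 * s * exp s := by positivity
      nlinarith
  have hquad (s : ℝ) : HasDerivAt (fun s : ℝ => -(2 * s ^ 2 + 27 * s + 83)) ((-4) * s + (-27)) s := by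
    have := (((((hasDerivAt_id s).pow 2).const_mul 2).add
      ((hasDerivAt_id s).const_mul (27 : ℝ))).add_const (83 : ℝ)).neg
    refine this.congr_deriv ?_
    simp; ring
  have := pos_of_hasDerivAt_pos (f := fun t => (729 * t + (-729)) * exp t ^ 2 +
      (128 * t + 832) * exp t + -(2 * t ^ 2 + 27 * t + 83))
      (fun s => ((((hlin 729 (-729) s).mul ((hE s).pow 2)).add
        ((hlin 128 832 s).mul (hE s))).add (hquad s)).congr_deriv (by
          simp only [Pi.pow_apply]; push_cast; ring)) (by norm_num) h1 ht
  simpa [sub_eq_add_neg] using this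

lemma expPoly_pos {t : ℝ} (ht : 0 < t) : 0 < expPoly 1 (-3) 2 7 (-2) (-3) (-5) 1 t := by
  revert t
  iterate 6
    refine fun {t} ht => expPoly_pos_of_deriv (by norm_num) ?_ t ht
    norm_num only
  intro t ht
  rw [expPoly_eq_exp_mul]
  have := exp_quadratic_pos t ht
  have h2 := exp_pos t
  refine mul_pos h2 ?_
  linarith

lemma one_add_lt_exp {t : ℝ} (ht : 0 < t) : 0 < exp t - 1 - t := by
  linarith [add_one_lt_exp ht.ne']

/-- The density whose Laplace transform is `Phi`. -/
noncomputable def phiDensity (t : ℝ) : ℝ := exp t * (exp t - 1 - t) / (exp t - 1) ^ 2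

/-- The logarithmic derivative of `phiDensity`. -/
noncomputable def phiLogDeriv (t : ℝ) : ℝ := t / (exp t - 1 - t) - 2 / (exp t - 1)

lemma phiDensity_pos {t : ℝ} (ht : 0 < t) : 0 < phiDensity t := by
  have h1 := one_add_lt_exp ht
  have h2 : 0 < exp t - 1 := by linarith
  unfold phiDensity
  positivity

lemma phiDensity_nonneg {t : ℝ} (ht : 0 ≤ t) : 0 ≤ phiDensity t := by
  rcases ht.eq_or_lt with rfl | h
  · simp [phiDensity]
  · exact (phiDensity_pos h).le

lemma phiDensity_le_one {t : ℝ} (ht : 0 ≤ t) : phiDensity t ≤ 1 := by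
  rcases ht.eq_or_lt with rfl | h
  · simp [phiDensity]
  · have h1 := one_add_lt_exp h
    have h2 : 0 < exp t - 1 := by linarith
    unfold phiDensity
    rw [div_le_one (by positivity)]
    have h3 : (1 - t) * exp t ≤ 1 := by
      have := add_one_le_exp (-t)
      calc (1 - t) * exp t ≤ exp (-t) * exp t := by gcongr; linarith
        _ = 1 := by rw [← exp_add]; simp
    nlinarith

lemma measurable_phiDensity : Measurable phiDensity := by
  unfold phiDensity; fun_prop

lemma hasDerivAt_log_phiDensity {t : ℝ} (ht : 0 < t) :
    HasDerivAt (fun s => log (phiDensity s)) (phiLogDeriv t) t := by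
  have h1 := one_add_lt_exp ht
  have h2 : 0 < exp t - 1 := by linarith
  have hE := hasDerivAt_exp t
  have h := ((hE.mul ((hE.sub_const 1).sub (hasDerivAt_id t))).div ((hE.sub_const 1).pow 2)
    (by simp; positivity)).log (phiDensity_pos ht).ne'
  refine h.congr_deriv ?_
  simp only [phiLogDeriv, Pi.pow_apply, Pi.mul_apply, Pi.sub_apply, id, Pi.div_apply]
  field_simp
  ring

lemma hasDerivAt_phiLogDeriv {t : ℝ} (ht : 0 < t) :
    HasDerivAt phiLogDeriv
      (-(expPoly 1 (-3) 2 7 (-2) (-3) (-5) 1 t / ((exp t - 1 - t) ^ 2 * (exp t - 1) ^ 2))) t := by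
  have h1 := one_add_lt_exp ht
  have h2 : 0 < exp t - 1 := by linarith
  have hE := hasDerivAt_exp t
  have h := ((hasDerivAt_id t).div ((hE.sub_const 1).sub (hasDerivAt_id t)) h1.ne').sub
    ((hasDerivAt_const t (2 : ℝ)).div (hE.sub_const 1) h2.ne')
  refine h.congr_deriv ?_
  simp only [expPoly, Pi.sub_apply, id]
  field_simp
  ring

lemma phiLogDeriv_strictAntiOn : StrictAntiOn phiLogDeriv (Ioi 0) := by
  refine strictAntiOn_of_deriv_neg (convex_Ioi 0)
    (fun t ht => (hasDerivAt_phiLogDeriv ht).continuousAt.continuousWithinAt) fun t ht => ?_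
  rw [interior_Ioi] at ht
  rw [(hasDerivAt_phiLogDeriv ht).deriv, neg_lt_zero]
  have h1 := one_add_lt_exp ht
  have h2 : 0 < exp t - 1 := by linarith [mem_Ioi.1 ht]
  exact div_pos (expPoly_pos ht) (by positivity)

lemma phiDensity_ratio_strictMonoOn {u : ℝ} (hu : u ∈ Ioo (0 : ℝ) 1) :
    StrictMonoOn (fun t => phiDensity (t * u) * phiDensity (t * (1 - u)) / phiDensity t)
      (Ioi 0) := by
  obtain ⟨hu0, hu1⟩ := hu
  have hv0 : 0 < 1 - u := by linarith
  have hd : ∀ t ∈ Ioi (0 : ℝ), HasDerivAt (fun t => log (phiDensity (t * u)) +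
      log (phiDensity (t * (1 - u))) - log (phiDensity t))
      (phiLogDeriv (t * u) * u + phiLogDeriv (t * (1 - u)) * (1 - u) - phiLogDeriv t) t := by
    intro t (ht : 0 < t)
    have hs (v : ℝ) (hv : 0 < v) : HasDerivAt (fun t => log (phiDensity (t * v)))
        (phiLogDeriv (t * v) * v) t :=
      HasDerivAt.comp (h₂ := fun s => log (phiDensity s)) t
        (hasDerivAt_log_phiDensity (mul_pos ht hv)) (by simpa using (hasDerivAt_id t).mul_const v)
    exact ((hs u hu0).add (hs _ hv0)).sub (hasDerivAt_log_phiDensity ht)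
  have hlog : StrictMonoOn (fun t => log (phiDensity (t * u)) +
      log (phiDensity (t * (1 - u))) - log (phiDensity t)) (Ioi 0) := by
    refine strictMonoOn_of_deriv_pos (convex_Ioi 0)
      (fun t ht => (hd t ht).continuousAt.continuousWithinAt) fun t ht => ?_
    rw [interior_Ioi] at ht
    rw [(hd t ht).deriv]
    have ht' : 0 < t := ht
    have h1 := phiLogDeriv_strictAntiOn (mul_pos ht' hu0) ht (by nlinarith : t * u < t)
    have h2 := phiLogDeriv_strictAntiOn (mul_pos ht' hv0) ht (by nlinarith : t * (1 - u) < t)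
    nlinarith
  intro a ha b hb hab
  have hp {t : ℝ} (ht : t ∈ Ioi (0 : ℝ)) := phiDensity_pos (mul_pos (mem_Ioi.1 ht) hu0)
  have hq {t : ℝ} (ht : t ∈ Ioi (0 : ℝ)) := phiDensity_pos (mul_pos (mem_Ioi.1 ht) hv0)
  have hr {t : ℝ} (ht : t ∈ Ioi (0 : ℝ)) := phiDensity_pos (mem_Ioi.1 ht)
  have h := hlog ha hb hab
  simp only at h
  rw [← log_mul (hp ha).ne' (hq ha).ne', ← log_mul (hp hb).ne' (hq hb).ne',
    ← log_div (mul_pos (hp ha) (hq ha)).ne' (hr ha).ne',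
    ← log_div (mul_pos (hp hb) (hq hb)).ne' (hr hb).ne'] at h
  exact (log_lt_log_iff (div_pos (mul_pos (hp ha) (hq ha)) (hr ha))
    (div_pos (mul_pos (hp hb) (hq hb)) (hr hb))).1 h

lemma integrableOn_pow_mul_exp_neg_mul (k : ℕ) {x : ℝ} (hx : 0 < x) :
    IntegrableOn (fun t => t ^ k * exp (-x * t)) (Ioi 0) := by
  have h := integrableOn_rpow_mul_exp_neg_mul_rpow (p := 1) (s := k) (b := x)
    (by linarith [k.cast_nonneg (α := ℝ)]) one_pos hx
  simpa using h

/-- The `k`-th moment `∫ t ^ k * f t * exp (-x t)` of the Laplace transform of `f`. -/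
noncomputable def laplaceMoment (f : ℝ → ℝ) (k : ℕ) (x : ℝ) : ℝ :=
  ∫ t in Ioi 0, t ^ k * f t * exp (-x * t)

section Laplace

variable {f : ℝ → ℝ}

lemma integrableOn_laplaceMoment (hf : Measurable f) (hb : ∀ t, 0 < t → |f t| ≤ 1 + t) (k : ℕ)
    {x : ℝ} (hx : 0 < x) : IntegrableOn (fun t => t ^ k * f t * exp (-x * t)) (Ioi 0) := by
  refine Integrable.mono' ((integrableOn_pow_mul_exp_neg_mul k hx).add
    (integrableOn_pow_mul_exp_neg_mul (k + 1) hx)) (by fun_prop) ?_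
  refine (ae_restrict_iff' measurableSet_Ioi).2 (ae_of_all _ fun t (ht : 0 < t) => ?_)
  rw [norm_mul, norm_mul, norm_eq_abs, norm_eq_abs, norm_eq_abs, abs_of_pos (pow_pos ht k),
    abs_of_pos (exp_pos _), Pi.add_apply]
  calc t ^ k * |f t| * exp (-x * t) ≤ t ^ k * (1 + t) * exp (-x * t) := by
        gcongr; exact hb t ht
    _ = _ := by ring

lemma hasDerivAt_laplaceMoment (hf : Measurable f) (hb : ∀ t, 0 < t → |f t| ≤ 1 + t) (k : ℕ)
    {x : ℝ} (hx : 0 < x) :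
    HasDerivAt (laplaceMoment f k) (-laplaceMoment f (k + 1) x) x := by
  have hx2 : 0 < x / 2 := by linarith
  have h := (hasDerivAt_integral_of_dominated_loc_of_deriv_le (μ := volume.restrict (Ioi 0))
    (F := fun x t => t ^ k * f t * exp (-x * t))
    (F' := fun x t => -(t ^ (k + 1) * f t * exp (-x * t)))
    (bound := fun t => ‖t ^ (k + 1) * f t * exp (-(x / 2) * t)‖)
    (Ioi_mem_nhds (by linarith : x / 2 < x)) (Eventually.of_forall fun y => by fun_prop)
    (integrableOn_laplaceMoment hf hb k hx) (by fun_prop) ?_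
    (integrableOn_laplaceMoment hf hb (k + 1) hx2).norm ?_).2
  · rw [integral_neg] at h
    exact h
  · refine (ae_restrict_iff' measurableSet_Ioi).2 (ae_of_all _ fun t (ht : 0 < t) y hy => ?_)
    rw [norm_neg, norm_mul, norm_mul (t ^ (k + 1) * f t), norm_of_nonneg (exp_pos _).le,
      norm_of_nonneg (exp_pos _).le]
    have : x / 2 < y := hy
    gcongr
  · refine ae_of_all _ fun t y _ => ?_
    have h1 : HasDerivAt (fun y : ℝ => -y * t) (-t) y := by
      simpa using (hasDerivAt_id y).neg.mul_const t
    exact (h1.exp.const_mul (t ^ k * f t)).congr_deriv (by ring)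

lemma laplaceMoment_pos (hf : Measurable f) (hb : ∀ t, 0 < t → |f t| ≤ 1 + t)
    (hpos : ∀ t, 0 < t → 0 < f t) (k : ℕ) {x : ℝ} (hx : 0 < x) : 0 < laplaceMoment f k x := by
  have hp : ∀ t ∈ Ioi (0 : ℝ), 0 < t ^ k * f t * exp (-x * t) := fun t ht =>
    mul_pos (mul_pos (pow_pos ht k) (hpos t ht)) (exp_pos _)
  unfold laplaceMoment
  rw [setIntegral_pos_iff_support_of_nonneg_ae
    ((ae_restrict_iff' measurableSet_Ioi).2 (ae_of_all _ fun t ht => (hp t ht).le))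
    (integrableOn_laplaceMoment hf hb k hx)]
  have hsub : Ioi (0 : ℝ) ⊆ Function.support fun t => t ^ k * f t * exp (-x * t) :=
    fun t ht => (hp t ht).ne'
  rw [inter_eq_self_of_subset_right hsub]
  simp

end Laplace

lemma integral_pow_mul_exp_neg_mul (k : ℕ) {x : ℝ} (hx : 0 < x) :
    ∫ t in Ioi 0, t ^ k * exp (-x * t) = k.factorial / x ^ (k + 1) := by
  have h := integral_rpow_mul_exp_neg_mul_Ioi (a := (k + 1 : ℝ)) (r := x) (by positivity) hx
  rw [Gamma_nat_eq_factorial] at h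
  simp only [add_sub_cancel_right, rpow_natCast] at h
  simp only [neg_mul]
  rw [h, ← Nat.cast_add_one, rpow_natCast, one_div, inv_pow, mul_comm, div_eq_mul_inv]

/-- The density whose Laplace transform is the trigamma function. -/
noncomputable def trigammaDensity (t : ℝ) : ℝ := t * exp t / (exp t - 1)

lemma measurable_trigammaDensity : Measurable trigammaDensity := by
  unfold trigammaDensity; fun_prop

lemma trigammaDensity_pos {t : ℝ} (ht : 0 < t) : 0 < trigammaDensity t := by
  have h1 := one_add_lt_exp ht
  have h2 : 0 < exp t - 1 := by linarith
  unfold trigammaDensity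
  positivity

lemma trigammaDensity_abs_le {t : ℝ} (ht : 0 < t) : |trigammaDensity t| ≤ 1 + t := by
  rw [abs_of_pos (trigammaDensity_pos ht), trigammaDensity]
  have h1 := one_add_lt_exp ht
  rw [div_le_iff₀ (by linarith)]
  linarith

lemma phiDensity_abs_le {t : ℝ} (ht : 0 < t) : |phiDensity t| ≤ 1 + t := by
  rw [abs_of_pos (phiDensity_pos ht)]
  linarith [phiDensity_le_one ht.le]

lemma hasDerivAt_trigammaDensity {t : ℝ} (ht : 0 < t) :
    HasDerivAt trigammaDensity (phiDensity t) t := by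
  have h1 := one_add_lt_exp ht
  have h2 : 0 < exp t - 1 := by linarith
  have hE := hasDerivAt_exp t
  refine (((hasDerivAt_id t).mul hE).div (hE.sub_const 1) h2.ne').congr_deriv ?_
  simp only [phiDensity, Pi.mul_apply, id]
  field_simp
  ring

lemma tendsto_trigammaDensity_zero : Tendsto trigammaDensity (𝓝[>] 0) (𝓝 1) := by
  have h1 : Tendsto (fun t : ℝ => t⁻¹ * (exp t - 1)) (𝓝[>] 0) (𝓝 1) := by
    have := (hasDerivAt_exp 0).tendsto_slope_zero_right
    simpa using this
  have h2 : Tendsto exp (𝓝[>] 0) (𝓝 1) := by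
    have := (continuous_exp.tendsto 0).mono_left (nhdsWithin_le_nhds (s := Ioi 0))
    simpa using this
  have h3 := h2.div h1 one_ne_zero
  rw [div_one] at h3
  refine h3.congr' ?_
  filter_upwards [self_mem_nhdsWithin] with t (ht : 0 < t)
  have h4 := one_add_lt_exp ht
  have h5 : 0 < exp t - 1 := by linarith
  simp only [trigammaDensity, Pi.div_apply]
  field_simp

lemma tendsto_trigammaDensity_mul_exp {x : ℝ} (hx : 0 < x) :
    Tendsto (fun t => trigammaDensity t * exp (-x * t)) atTop (𝓝 0) := by
  have h0 := tendsto_rpow_mul_exp_neg_mul_atTop_nhds_zero 0 x hx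
  have h1 := tendsto_rpow_mul_exp_neg_mul_atTop_nhds_zero 1 x hx
  have h := h0.add h1
  rw [add_zero] at h
  refine squeeze_zero' ?_ ?_ h
  · filter_upwards [eventually_gt_atTop 0] with t ht
    exact (mul_pos (trigammaDensity_pos ht) (exp_pos _)).le
  · filter_upwards [eventually_gt_atTop 0] with t ht
    simp only [rpow_zero, rpow_one, ← add_mul]
    gcongr
    exact (le_abs_self _).trans (trigammaDensity_abs_le ht)

lemma laplaceMoment_phiDensity_zero {x : ℝ} (hx : 0 < x) :
    laplaceMoment phiDensity 0 x = x * laplaceMoment trigammaDensity 0 x - 1 := by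
  have hi := integrableOn_laplaceMoment measurable_trigammaDensity
    (fun t ht => trigammaDensity_abs_le ht) 0 hx
  have hj := integrableOn_laplaceMoment measurable_phiDensity (fun t ht => phiDensity_abs_le ht) 0 hx
  simp only [pow_zero, one_mul] at hi hj
  have hi' : IntegrableOn (fun t => trigammaDensity t * (-x * exp (-x * t))) (Ioi 0) :=
    (hi.const_mul (-x)).congr (ae_of_all _ fun t => by simp only; ring)
  have h := integral_Ioi_deriv_mul_eq_sub (a := 0) (a' := 1) (b' := 0)
    (u := trigammaDensity) (u' := phiDensity)
    (v := fun t => exp (-x * t)) (v' := fun t => -x * exp (-x * t))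
    (fun t ht => hasDerivAt_trigammaDensity ht) (fun t _ => ?_) (hj.add hi') ?_
    (tendsto_trigammaDensity_mul_exp hx)
  · rw [integral_add hj hi'] at h
    simp only [laplaceMoment, pow_zero, one_mul]
    rw [← integral_const_mul, eq_sub_iff_add_eq, ← eq_sub_iff_add_eq', zero_sub] at *
    have h2 : ∫ t in Ioi 0, trigammaDensity t * (-x * exp (-x * t)) =
        -∫ t in Ioi 0, x * (trigammaDensity t * exp (-x * t)) := by
      rw [← integral_neg]
      congr 1; ext t; ring
    linarith
  · have h1 : HasDerivAt (fun t : ℝ => -x * t) (-x) t := by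
      simpa using (hasDerivAt_id t).const_mul (-x)
    exact h1.exp.congr_deriv (by ring)
  · have h2 : Tendsto (fun t => exp (-x * t)) (𝓝[>] 0) (𝓝 1) := by
      have hc : Continuous fun t => exp (-x * t) := by fun_prop
      have := (hc.tendsto 0).mono_left (nhdsWithin_le_nhds (s := Ioi 0))
      simpa using this
    simpa using! tendsto_trigammaDensity_zero.mul h2

lemma laplaceMoment_trigammaDensity_add_one {x : ℝ} (hx : 0 < x) :
    laplaceMoment trigammaDensity 0 (x + 1) = laplaceMoment trigammaDensity 0 x - 1 / x ^ 2 := by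
  have hi {x : ℝ} (hx : 0 < x) := integrableOn_laplaceMoment measurable_trigammaDensity
    (fun t ht => trigammaDensity_abs_le ht) 0 hx
  have h1 := integral_pow_mul_exp_neg_mul 1 hx
  simp only [Nat.factorial_one, Nat.cast_one, one_add_one_eq_two, pow_one] at h1
  rw [← h1]
  unfold laplaceMoment
  rw [eq_sub_iff_add_eq, ← integral_add (hi (by linarith : 0 < x + 1))
    (by simpa using! integrableOn_pow_mul_exp_neg_mul 1 hx)]
  refine setIntegral_congr_fun measurableSet_Ioi fun t (ht : 0 < t) => ?_
  have h4 := one_add_lt_exp ht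
  have h5 : exp t - 1 ≠ 0 := by linarith
  have h6 : exp (-x * t) = exp (-(x + 1) * t) * exp t := by rw [← exp_add]; ring_nf
  simp only [trigammaDensity, h6]
  field_simp
  ring

lemma laplaceMoment_trigammaDensity_le {x : ℝ} (hx : 0 < x) :
    laplaceMoment trigammaDensity 0 x ≤ 1 / x + 1 / x ^ 2 := by
  have h0 := integral_pow_mul_exp_neg_mul 0 hx
  have h1 := integral_pow_mul_exp_neg_mul 1 hx
  simp only [Nat.factorial_zero, Nat.factorial_one, Nat.cast_one, one_add_one_eq_two,
    zero_add, pow_one] at h0 h1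
  have i0 := integrableOn_pow_mul_exp_neg_mul 0 hx
  have i1 := integrableOn_pow_mul_exp_neg_mul 1 hx
  simp only [pow_one] at i1
  rw [← h0, ← h1, ← integral_add i0 i1]
  refine setIntegral_mono_on (integrableOn_laplaceMoment measurable_trigammaDensity
    (fun t ht => trigammaDensity_abs_le ht) 0 hx) (i0.add i1) measurableSet_Ioi fun t ht => ?_
  have := (le_abs_self _).trans (trigammaDensity_abs_le (mem_Ioi.1 ht))
  calc t ^ 0 * trigammaDensity t * exp (-x * t) ≤ (1 + t) * exp (-x * t) := by
        rw [pow_zero, one_mul]; gcongr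
    _ = _ := by ring

/-- A monotone solution of `ψ (x + 1) = ψ x + 1 / x` is differentiable with derivative `T`, where
`T` is a decaying solution of the differenced equation. -/
lemma hasDerivAt_of_monotoneOn_of_add_one {ψ T : ℝ → ℝ} (hmono : MonotoneOn ψ (Ioi 0))
    (hψ : ∀ x, 0 < x → ψ (x + 1) = ψ x + 1 / x) (hTc : ContinuousOn T (Ioi 0))
    (hT : ∀ x, 0 < x → T (x + 1) = T x - 1 / x ^ 2) (hT0 : ∀ x, 0 < x → 0 ≤ T x)
    (hTle : ∀ x, 0 < x → T x ≤ 1 / x + 1 / x ^ 2) {x : ℝ} (hx : 0 < x) :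
    HasDerivAt ψ (T x) x := by
  obtain ⟨W, hW⟩ : ∃ W : ℝ → ℝ, ∀ x, 0 < x → HasDerivAt W (T x) x := by
    refine ⟨fun x => ∫ s in (1 : ℝ)..x, T s, fun x hx => ?_⟩
    refine intervalIntegral.integral_hasDerivAt_right ?_ ?_ (hTc.continuousAt (Ioi_mem_nhds hx))
    · refine (hTc.mono fun s hs => ?_).intervalIntegrable
      exact (lt_min one_pos hx).trans_le hs.1
    · exact hTc.stronglyMeasurableAtFilter isOpen_Ioi x hx
  -- the oscillation of `ψ - W` on unit intervals tends to zero
  have hosc : ∀ x y, 0 < x → x ≤ y → y ≤ x + 1 →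
      |(ψ y - W y) - (ψ x - W x)| ≤ 1 / x + 1 / x ^ 2 := by
    intro x y hx hxy hyx
    have hy : 0 < y := hx.trans_le hxy
    have a1 := hmono hx hy hxy
    have a2 := hmono hy (show 0 < x + 1 by linarith) hyx
    rw [hψ x hx] at a2
    have hbd : 0 ≤ W y - W x ∧ W y - W x ≤ 1 / x + 1 / x ^ 2 := by
      rcases hxy.eq_or_lt with rfl | hlt
      · simp; positivity
      · obtain ⟨c, hc, hcd⟩ := exists_hasDerivAt_eq_slope W T hlt
          (fun s hs => (hW s (hx.trans_le hs.1)).continuousAt.continuousWithinAt)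
          (fun s hs => hW s (hx.trans hs.1))
        have hc0 : 0 < c := hx.trans hc.1
        have e : W y - W x = T c * (y - x) := by
          rw [hcd]; field_simp [sub_ne_zero.2 hlt.ne']
        have b1 := hT0 c hc0
        have b2 : T c ≤ 1 / x + 1 / x ^ 2 := (hTle c hc0).trans (by
          have := hc.1.le
          gcongr)
        rw [e]
        constructor
        · exact mul_nonneg b1 (by linarith)
        · nlinarith
    have : 0 < 1 / x ^ 2 := by positivity
    rw [abs_le]
    constructor <;> linarith [hbd.1, hbd.2]
  have hlim : ∀ x : ℝ, Tendsto (fun n : ℕ => 1 / (x + n) + 1 / (x + n) ^ 2) atTop (𝓝 0) := by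
    intro x
    have h1 : Tendsto (fun n : ℕ => 1 / (x + n)) atTop (𝓝 0) := by
      simp only [one_div]
      exact tendsto_inv_atTop_zero.comp
        (tendsto_atTop_add_const_left _ _ tendsto_natCast_atTop_atTop)
    simpa [one_div, inv_pow] using h1.add (h1.pow 2)
  have hdiff : ∀ x, 0 < x → ∀ y, 0 < y →
      (ψ (x + 1) - W (x + 1)) - (ψ x - W x) = (ψ (y + 1) - W (y + 1)) - (ψ y - W y) := by
    have hd : ∀ x, 0 < x → HasDerivAt (fun x => 1 / x - W (x + 1) + W x) 0 x := by
      intro x hx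
      have h1 := hasDerivAt_inv hx.ne'
      have h2 := (hW (x + 1) (by linarith)).comp_add_const x 1
      simp only [one_div]
      refine ((h1.sub h2).add (hW x hx)).congr_deriv ?_
      rw [hT x hx]; ring
    intro x hx y hy
    have := (convex_Ioi (0 : ℝ)).is_const_of_fderivWithin_eq_zero (𝕜 := ℝ)
      (f := fun x => 1 / x - W (x + 1) + W x)
      (fun s hs => (hd s hs).differentiableAt.differentiableWithinAt)
      (fun s hs => by
        rw [fderivWithin_of_isOpen isOpen_Ioi hs]
        ext
        rw [fderiv_apply_one_eq_deriv, (hd s hs).deriv]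
        simp) hx hy
    rw [hψ x hx, hψ y hy]
    linarith
  have hper : ∀ x, 0 < x → ψ (x + 1) - W (x + 1) = ψ x - W x := by
    intro x hx
    have : Tendsto (fun _ : ℕ => (ψ (x + 1) - W (x + 1)) - (ψ x - W x)) atTop (𝓝 0) := by
      refine squeeze_zero_norm (fun n => ?_) (hlim x)
      have hxn : 0 < x + n := by positivity
      rw [hdiff x hx (x + n) hxn, norm_eq_abs]
      exact hosc _ _ hxn (by linarith) le_rfl
    exact sub_eq_zero.1 (tendsto_nhds_unique tendsto_const_nhds this)
  have hpern : ∀ n : ℕ, ∀ x, 0 < x → ψ (x + n) - W (x + n) = ψ x - W x := by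
    intro n
    induction n with
    | zero => simp
    | succ n ih =>
      intro x hx
      rw [Nat.cast_add_one, ← add_assoc, hper _ (by positivity), ih x hx]
  have hconst : ∀ x y, 0 < x → x ≤ y → y ≤ x + 1 → ψ y - W y = ψ x - W x := by
    intro x y hx hxy hyx
    have : Tendsto (fun _ : ℕ => (ψ y - W y) - (ψ x - W x)) atTop (𝓝 0) := by
      refine squeeze_zero_norm (fun n => ?_) (hlim x)
      have hxn : 0 < x + n := by positivity
      rw [← hpern n x hx, ← hpern n y (hx.trans_le hxy), norm_eq_abs]
      exact hosc _ _ hxn (by linarith) (by linarith)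
    exact sub_eq_zero.1 (tendsto_nhds_unique tendsto_const_nhds this)
  obtain ⟨b, hb0, hbx, hxb⟩ : ∃ b, 0 < b ∧ b < x ∧ x < b + 1 := by
    rcases le_or_gt x 1 with h | h
    · exact ⟨x / 2, by linarith, by linarith, by linarith⟩
    · exact ⟨x - 1 / 2, by linarith, by linarith, by linarith⟩
  refine ((hW x hx).add_const (ψ b - W b)).congr_of_eventuallyEq ?_
  filter_upwards [Ioo_mem_nhds hbx hxb] with y hy
  rw [← hconst b y hb0 hy.1.le hy.2.le]
  ring

lemma hasDerivAt_deriv_log_Gamma {x : ℝ} (hx : 0 < x) :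
    HasDerivAt (deriv fun y => log (Gamma y)) (laplaceMoment trigammaDensity 0 x) x := by
  have hT : ∀ x, 0 < x → HasDerivAt (laplaceMoment trigammaDensity 0)
      (-laplaceMoment trigammaDensity 1 x) x := fun x hx =>
    hasDerivAt_laplaceMoment measurable_trigammaDensity (fun t ht => trigammaDensity_abs_le ht) 0 hx
  have hd : ∀ x, 0 < x → DifferentiableAt ℝ (fun y => log (Gamma y)) x := fun x hx =>
    (differentiableAt_Gamma fun m => by linarith [m.cast_nonneg (α := ℝ)]).log (Gamma_pos_of_pos hx).ne'
  refine hasDerivAt_of_monotoneOn_of_add_one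
    (convexOn_log_Gamma.monotoneOn_deriv hd) (fun x hx => ?_)
    (fun x hx => (hT x hx).continuousAt.continuousWithinAt)
    (fun x hx => laplaceMoment_trigammaDensity_add_one hx)
    (fun x hx => (laplaceMoment_pos measurable_trigammaDensity
      (fun t ht => trigammaDensity_abs_le ht) (fun t ht => trigammaDensity_pos ht) 0 hx).le)
    (fun x hx => laplaceMoment_trigammaDensity_le hx) hx
  have h1 := (hd (x + 1) (by linarith)).hasDerivAt.comp_add_const x 1
  have h2 := ((hd x hx).hasDerivAt.add (hasDerivAt_log hx.ne'))
  rw [one_div]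
  refine (h1.congr_of_eventuallyEq ?_).unique h2 |>.symm ▸ rfl
  filter_upwards [Ioi_mem_nhds hx] with y hy
  simp only [Pi.add_apply]
  rw [Gamma_add_one (ne_of_gt hy), log_mul (ne_of_gt hy) (Gamma_pos_of_pos hy).ne', add_comm]

lemma Phi_eq_laplaceMoment {x : ℝ} (hx : 0 < x) : Phi x = laplaceMoment phiDensity 0 x := by
  rw [laplaceMoment_phiDensity_zero hx, Phi, iteratedDeriv_succ, iteratedDeriv_one,
    (hasDerivAt_deriv_log_Gamma hx).deriv]

lemma hasDerivAt_phiMoment (k : ℕ) {x : ℝ} (hx : 0 < x) :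
    HasDerivAt (laplaceMoment phiDensity k) (-laplaceMoment phiDensity (k + 1) x) x :=
  hasDerivAt_laplaceMoment measurable_phiDensity (fun _ ht => phiDensity_abs_le ht) k hx

lemma phiMoment_pos (k : ℕ) {x : ℝ} (hx : 0 < x) : 0 < laplaceMoment phiDensity k x :=
  laplaceMoment_pos measurable_phiDensity (fun _ ht => phiDensity_abs_le ht)
    (fun _ ht => phiDensity_pos ht) k hx

lemma iteratedDeriv_Phi (k : ℕ) {x : ℝ} (hx : 0 < x) :
    iteratedDeriv k Phi x = (-1) ^ k * laplaceMoment phiDensity k x := by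
  induction k generalizing x with
  | zero => simp [Phi_eq_laplaceMoment hx]
  | succ k ih =>
    have h : iteratedDeriv k Phi =ᶠ[𝓝 x] fun y => (-1) ^ k * laplaceMoment phiDensity k y := by
      filter_upwards [Ioi_mem_nhds hx] with y hy using ih hy
    rw [iteratedDeriv_succ, h.deriv_eq, ((hasDerivAt_phiMoment k hx).const_mul _).deriv]
    ring

/-- The convolution of `s ^ m * phiDensity s` and `s ^ n * phiDensity s` on `(0, t)`. -/
noncomputable def phiConv (m n : ℕ) (t : ℝ) : ℝ :=
  ∫ s in (0 : ℝ)..t, s ^ m * phiDensity s * ((t - s) ^ n * phiDensity (t - s))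

lemma phiConv_mul_exp (m n : ℕ) (x t : ℝ) :
    ∫ s in (0 : ℝ)..t, ContinuousLinearMap.mul ℝ ℝ (s ^ m * phiDensity s * exp (-x * s))
      ((t - s) ^ n * phiDensity (t - s) * exp (-x * (t - s))) = phiConv m n t * exp (-x * t) := by
  rw [phiConv, ← intervalIntegral.integral_mul_const]
  congr 1
  ext s
  have : exp (-x * t) = exp (-x * s) * exp (-x * (t - s)) := by rw [← exp_add]; ring_nf
  rw [this, ContinuousLinearMap.mul_apply']
  ring

lemma integrableOn_phiMoment (k : ℕ) {x : ℝ} (hx : 0 < x) :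
    IntegrableOn (fun t => t ^ k * phiDensity t * exp (-x * t)) (Ioi 0) :=
  integrableOn_laplaceMoment measurable_phiDensity (fun _ ht => phiDensity_abs_le ht) k hx

lemma integrableOn_phiConv (m n : ℕ) {x : ℝ} (hx : 0 < x) :
    IntegrableOn (fun t => phiConv m n t * exp (-x * t)) (Ioi 0) := by
  have h := integrable_posConvolution (integrableOn_phiMoment m hx) (integrableOn_phiMoment n hx)
    (ContinuousLinearMap.mul ℝ ℝ)
  unfold posConvolution at h
  rw [integrable_indicator_iff measurableSet_Ioi] at h
  simpa only [phiConv_mul_exp] using h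

lemma integral_phiConv (m n : ℕ) {x : ℝ} (hx : 0 < x) :
    ∫ t in Ioi 0, phiConv m n t * exp (-x * t) =
      laplaceMoment phiDensity m x * laplaceMoment phiDensity n x := by
  unfold laplaceMoment
  have h := integral_posConvolution (integrableOn_phiMoment m hx) (integrableOn_phiMoment n hx)
    (ContinuousLinearMap.mul ℝ ℝ)
  simp only [phiConv_mul_exp] at h
  exact h

lemma intervalIntegrable_phiConv (m n : ℕ) {t : ℝ} (ht : 0 ≤ t) :
    IntervalIntegrable (fun s => s ^ m * phiDensity s * ((t - s) ^ n * phiDensity (t - s)))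
      volume 0 t := by
  have hm := measurable_phiDensity
  have hc : Continuous fun s : ℝ => s ^ m * (t - s) ^ n := by fun_prop
  refine (hc.intervalIntegrable 0 t).mono_fun (by fun_prop) ?_
  refine (ae_restrict_iff' measurableSet_uIoc).2 (ae_of_all _ fun s hs => ?_)
  rw [uIoc_of_le ht] at hs
  have hts : 0 ≤ t - s := by linarith [hs.2]
  simp only [norm_mul, norm_of_nonneg (phiDensity_nonneg hs.1.le),
    norm_of_nonneg (phiDensity_nonneg hts)]
  have h1 := phiDensity_le_one hs.1.le
  have h2 := phiDensity_le_one hts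
  have h3 := phiDensity_nonneg hs.1.le
  have h4 := phiDensity_nonneg hts
  gcongr
  · exact mul_le_of_le_one_right (norm_nonneg _) h1
  · exact mul_le_of_le_one_right (norm_nonneg _) h2

lemma mul_phiConv (m n : ℕ) {t : ℝ} (ht : 0 ≤ t) :
    t * phiConv m n t = phiConv (m + 1) n t + phiConv m (n + 1) t := by
  unfold phiConv
  rw [← intervalIntegral.integral_add (intervalIntegrable_phiConv _ _ ht)
    (intervalIntegrable_phiConv _ _ ht), ← intervalIntegral.integral_const_mul]
  congr 1
  ext s
  ring

lemma integrableOn_mul_phiConv (m n : ℕ) {x : ℝ} (hx : 0 < x) :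
    IntegrableOn (fun t => t * phiConv m n t * exp (-x * t)) (Ioi 0) := by
  refine ((integrableOn_phiConv (m + 1) n hx).add (integrableOn_phiConv m (n + 1) hx)).congr_fun
    (fun t (ht : 0 < t) => ?_) measurableSet_Ioi
  simp only [Pi.add_apply]
  rw [mul_phiConv m n ht.le, add_mul]

lemma integral_mul_phiConv (m n : ℕ) {x : ℝ} (hx : 0 < x) :
    ∫ t in Ioi 0, t * phiConv m n t * exp (-x * t) =
      laplaceMoment phiDensity (m + 1) x * laplaceMoment phiDensity n x +
        laplaceMoment phiDensity m x * laplaceMoment phiDensity (n + 1) x := by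
  rw [← integral_phiConv (m + 1) n hx, ← integral_phiConv m (n + 1) hx,
    ← integral_add (integrableOn_phiConv (m + 1) n hx) (integrableOn_phiConv m (n + 1) hx)]
  refine setIntegral_congr_fun measurableSet_Ioi fun t (ht : 0 < t) => ?_
  rw [mul_phiConv m n ht.le, add_mul]

/-- The integrand of the rescaled quotient of `phiConv m n t` and
`t ^ (m + n + 1) * phiDensity t`. -/
noncomputable def phiRatioIntegrand (m n : ℕ) (t u : ℝ) : ℝ :=
  u ^ m * (1 - u) ^ n * (phiDensity (t * u) * phiDensity (t * (1 - u)) / phiDensity t)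

lemma phiConv_integrand_rescale (m n : ℕ) {t : ℝ} (ht : 0 < t) (u : ℝ) :
    (t * u) ^ m * phiDensity (t * u) * ((t - t * u) ^ n * phiDensity (t - t * u)) =
      t ^ (m + n) * phiDensity t * phiRatioIntegrand m n t u := by
  have e : t - t * u = t * (1 - u) := by ring
  have h := (phiDensity_pos ht).ne'
  rw [e, phiRatioIntegrand, mul_pow, mul_pow, pow_add]
  generalize phiDensity (t * u) = p
  generalize phiDensity (t * (1 - u)) = q
  generalize 1 - u = v
  field_simp

lemma phiConv_eq (m n : ℕ) {t : ℝ} (ht : 0 < t) :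
    phiConv m n t =
      (∫ u in (0 : ℝ)..1, phiRatioIntegrand m n t u) * (t ^ (m + n + 1) * phiDensity t) := by
  have h := intervalIntegral.smul_integral_comp_mul_left
    (fun s => s ^ m * phiDensity s * ((t - s) ^ n * phiDensity (t - s))) t (a := 0) (b := 1)
  rw [mul_zero, mul_one, smul_eq_mul] at h
  rw [phiConv, ← h]
  simp only [phiConv_integrand_rescale m n ht]
  rw [intervalIntegral.integral_const_mul]
  ring

lemma intervalIntegrable_phiRatioIntegrand (m n : ℕ) {t : ℝ} (ht : 0 < t) :
    IntervalIntegrable (phiRatioIntegrand m n t) volume 0 1 := by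
  have h := (intervalIntegrable_phiConv m n ht.le).comp_mul_left (c := t)
  rw [zero_div, div_self ht.ne'] at h
  simp only [phiConv_integrand_rescale m n ht] at h
  have hc : t ^ (m + n) * phiDensity t ≠ 0 :=
    (mul_pos (pow_pos ht _) (phiDensity_pos ht)).ne'
  refine (h.const_mul (t ^ (m + n) * phiDensity t)⁻¹).congr fun u _ => ?_
  rw [inv_mul_cancel_left₀ hc]

lemma phiRatio_strictMonoOn (m n : ℕ) :
    StrictMonoOn (fun t => ∫ u in (0 : ℝ)..1, phiRatioIntegrand m n t u) (Ioi 0) := by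
  intro a ha b hb hab
  have ia := intervalIntegrable_phiRatioIntegrand m n ha
  have ib := intervalIntegrable_phiRatioIntegrand m n hb
  rw [← sub_pos, ← intervalIntegral.integral_sub ib ia]
  refine intervalIntegral.intervalIntegral_pos_of_pos_on (ib.sub ia) (fun u hu => ?_) one_pos
  have h := phiDensity_ratio_strictMonoOn hu ha hb hab
  have h1 : 0 < u ^ m * (1 - u) ^ n :=
    mul_pos (pow_pos hu.1 m) (pow_pos (sub_pos.2 hu.2) n)
  exact sub_pos.2 (mul_lt_mul_of_pos_left h h1)

/-- Chebyshev's inequality for the measure `t ^ (m + n + 1) * phiDensity t * exp (-x t)` and the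
increasing function `phiConv m n t / (t ^ (m + n + 1) * phiDensity t)`. -/
lemma phiMoment_inequality (m n : ℕ) {x : ℝ} (hx : 0 < x) :
    laplaceMoment phiDensity (m + n + 2) x *
        (laplaceMoment phiDensity m x * laplaceMoment phiDensity n x) <
      laplaceMoment phiDensity (m + n + 1) x *
        (laplaceMoment phiDensity (m + 1) x * laplaceMoment phiDensity n x +
          laplaceMoment phiDensity m x * laplaceMoment phiDensity (n + 1) x) := by
  rw [← integral_phiConv m n hx, ← integral_mul_phiConv m n hx]
  have p0 := phiMoment_pos (m + n + 1) hx
  have p1 := phiMoment_pos (m + n + 2) hx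
  set I₀ := laplaceMoment phiDensity (m + n + 1) x
  set I₁ := laplaceMoment phiDensity (m + n + 2) x
  set τ := I₁ / I₀
  set κ := fun t => ∫ u in (0 : ℝ)..1, phiRatioIntegrand m n t u
  have hτ : 0 < τ := div_pos p1 p0
  have i0 := integrableOn_phiMoment (m + n + 1) hx
  have i1 := integrableOn_phiMoment (m + n + 2) hx
  have j0 := integrableOn_phiConv m n hx
  have j1 := integrableOn_mul_phiConv m n hx
  have hJ : IntegrableOn (fun t => t * phiConv m n t * exp (-x * t) -
      τ * (phiConv m n t * exp (-x * t))) (Ioi 0) := j1.sub (j0.const_mul τ)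
  have hI : IntegrableOn (fun t => κ τ * (t ^ (m + n + 2) * phiDensity t * exp (-x * t) -
      τ * (t ^ (m + n + 1) * phiDensity t * exp (-x * t)))) (Ioi 0) :=
    (i1.sub (i0.const_mul τ)).const_mul (κ τ)
  have hint : IntegrableOn (fun t => (t * phiConv m n t * exp (-x * t) -
      τ * (phiConv m n t * exp (-x * t))) -
      κ τ * (t ^ (m + n + 2) * phiDensity t * exp (-x * t) -
        τ * (t ^ (m + n + 1) * phiDensity t * exp (-x * t)))) (Ioi 0) :=
    hJ.sub hI
  have hfac : ∀ t, 0 < t → (t * phiConv m n t * exp (-x * t) -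
      τ * (phiConv m n t * exp (-x * t))) -
      κ τ * (t ^ (m + n + 2) * phiDensity t * exp (-x * t) -
        τ * (t ^ (m + n + 1) * phiDensity t * exp (-x * t))) =
      (t - τ) * (κ t - κ τ) * (t ^ (m + n + 1) * phiDensity t * exp (-x * t)) := by
    intro t ht
    rw [phiConv_eq m n ht]
    ring
  have hw : ∀ t, 0 < t → 0 < t ^ (m + n + 1) * phiDensity t * exp (-x * t) := fun t ht =>
    mul_pos (mul_pos (pow_pos ht _) (phiDensity_pos ht)) (exp_pos _)
  have hpos : ∀ t, 0 < t → t ≠ τ → 0 < (t - τ) * (κ t - κ τ) := by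
    intro t ht hne
    rcases hne.lt_or_gt with h | h
    · exact mul_pos_of_neg_of_neg (sub_neg.2 h)
        (sub_neg.2 (phiRatio_strictMonoOn m n ht hτ h))
    · exact mul_pos (sub_pos.2 h) (sub_pos.2 (phiRatio_strictMonoOn m n hτ ht h))
  have hmain := (setIntegral_pos_iff_support_of_nonneg_ae
    ((ae_restrict_iff' measurableSet_Ioi).2 (ae_of_all _ fun t ht => by
      rw [Pi.zero_apply, hfac t ht]
      refine mul_nonneg ?_ (hw t ht).le
      by_cases h : t = τ
      · simp [h]
      · exact (hpos t ht h).le)) hint).2 (by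
    refine lt_of_lt_of_le (b := volume (Ioi τ)) (by simp) (measure_mono fun t (ht : τ < t) => ?_)
    have ht0 : 0 < t := hτ.trans ht
    refine ⟨?_, ht0⟩
    rw [Function.mem_support, hfac t ht0]
    exact (mul_pos (hpos t ht0 ht.ne') (hw t ht0)).ne')
  rw [integral_sub hJ hI, integral_sub j1 (j0.const_mul τ), integral_const_mul, integral_const_mul,
    integral_sub i1 (i0.const_mul τ), integral_const_mul] at hmain
  change 0 < _ - κ τ * (I₁ - τ * I₀) at hmain
  have hτI : τ * I₀ = I₁ := div_mul_cancel₀ _ p0.ne'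
  rw [hτI, sub_self, mul_zero, sub_zero] at hmain
  have h := mul_pos p0 hmain
  rw [mul_sub, ← mul_assoc, mul_comm I₀ τ, hτI] at h
  linarith

lemma phiMoment_quotient_strictMonoOn (m n : ℕ) :
    StrictMonoOn (fun x => laplaceMoment phiDensity (m + n + 1) x /
      (laplaceMoment phiDensity m x * laplaceMoment phiDensity n x)) (Ioi 0) := by
  have hd := fun x (hx : x ∈ Ioi (0 : ℝ)) => (hasDerivAt_phiMoment (m + n + 1) hx).div
    ((hasDerivAt_phiMoment m hx).mul (hasDerivAt_phiMoment n hx))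
    (mul_pos (phiMoment_pos m hx) (phiMoment_pos n hx)).ne'
  refine strictMonoOn_of_deriv_pos (convex_Ioi 0)
    (fun x hx => (hd x hx).continuousAt.continuousWithinAt) fun x hx => ?_
  rw [interior_Ioi] at hx
  refine lt_of_lt_of_eq ?_ (hd x hx).deriv.symm
  have h := phiMoment_inequality m n hx
  refine div_pos ?_ (pow_pos (mul_pos (phiMoment_pos m hx) (phiMoment_pos n hx)) 2)
  simp only [Pi.mul_apply]
  linarith

theorem Y_strictAnti (m n : ℕ) : StrictAntiOn (Y m n) (Set.Ioi 0) := by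
  have hY : ∀ x ∈ Ioi (0 : ℝ), Y m n x = -(laplaceMoment phiDensity (m + n + 1) x /
      (laplaceMoment phiDensity m x * laplaceMoment phiDensity n x)) := by
    intro x hx
    rw [Y, iteratedDeriv_Phi _ hx, iteratedDeriv_Phi _ hx, iteratedDeriv_Phi _ hx]
    have h1 := (phiMoment_pos m hx).ne'
    have h2 := (phiMoment_pos n hx).ne'
    field_simp
    ring
  intro a ha b hb hab
  rw [hY a ha, hY b hb]
  exact neg_lt_neg (phiMoment_quotient_strictMonoOn m n ha hb hab)
end
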